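/- Let ω₁, ω₂ be weights on ℝ^n and ν = ω₁^{1/2}ω₂^{1/2}. Then (ω₁,ω₂) ∈ A_{(2,2)} if and only if ω₁^{−1} ∈ A₄, ω₂^{−1} ∈ A₄, and ν ∈ A₂. -/

import Mathlib

open MeasureTheory ENNReal Filter Set
open scoped ENNReal NNReal

noncomputable section

/-- Euclidean space ℝⁿ. -/
abbrev Euc (n : ℕ) := EuclideanSpace ℝ (Fin n)

/-- The axis-parallel cube with center `c` and half side-length `h`. -/
def cube {n : ℕ} (c : Euc n) (h : ℝ) : Set (Euc n) := {x | ∀ i, |x i - c i| ≤ h}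

/-- A weight: a locally integrable, a.e. positive function. -/
def IsWeight {n : ℕ} (w : Euc n → ℝ) : Prop :=
  LocallyIntegrable w volume ∧ ∀ᵐ x : Euc n ∂volume, 0 < w x

/-- Average of (the nonnegative part of) `w` over the cube `cube c h`, valued in `ℝ≥0∞`. -/
def eAvg {n : ℕ} (w : Euc n → ℝ) (c : Euc n) (h : ℝ) : ℝ≥0∞ :=
  (∫⁻ x in cube c h, ENNReal.ofReal (w x)) / volume (cube c h)

/-- Conjugate exponent `p' = p/(p-1)`. -/
def conjExp (p : ℝ) : ℝ := p / (p - 1)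

/-- The `A_p` ratio over a fixed cube. -/
def apRatio {n : ℕ} (p : ℝ) (w : Euc n → ℝ) (c : Euc n) (h : ℝ) : ℝ≥0∞ :=
  eAvg w c h * (eAvg (fun x => w x ^ (1 - conjExp p)) c h) ^ (p - 1)

/-- The Muckenhoupt `A_p` constant. -/
def apConst (n : ℕ) (p : ℝ) (w : Euc n → ℝ) : ℝ≥0∞ :=
  ⨆ (c : Euc n) (h : ℝ) (_ : 0 < h), apRatio p w c h

/-- Hardy–Littlewood maximal function (over cubes), `ℝ≥0∞`-valued. -/
def hlMax {n : ℕ} (f : Euc n → ℝ) (x : Euc n) : ℝ≥0∞ :=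
  ⨆ (c : Euc n) (h : ℝ) (_ : 0 < h) (_ : x ∈ cube c h),
    (∫⁻ y in cube c h, ENNReal.ofReal |f y|) / volume (cube c h)

/-- The Fujii–Wilson `B_∞` ratio over a fixed cube. -/
def bRatio {n : ℕ} (w : Euc n → ℝ) (c : Euc n) (h : ℝ) : ℝ≥0∞ :=
  (∫⁻ x in cube c h, hlMax ((cube c h).indicator w) x) /
    (∫⁻ x in cube c h, ENNReal.ofReal (w x))

/-- The Fujii–Wilson `B_∞` constant. -/
def bConst (n : ℕ) (w : Euc n → ℝ) : ℝ≥0∞ :=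
  ⨆ (c : Euc n) (h : ℝ) (_ : 0 < h), bRatio w c h

/-- The bilinear `A_{(2,2)}` ratio over a fixed cube. -/
def a22Ratio {n : ℕ} (w1 w2 : Euc n → ℝ) (c : Euc n) (h : ℝ) : ℝ≥0∞ :=
  eAvg (fun x => w1 x ^ ((1:ℝ)/2) * w2 x ^ ((1:ℝ)/2)) c h *
    ((eAvg (fun x => (w1 x)⁻¹) c h) ^ ((1:ℝ)/2) * (eAvg (fun x => (w2 x)⁻¹) c h) ^ ((1:ℝ)/2))

/-- The bilinear `A_{(2,2)}` constant. -/
def a22Const (n : ℕ) (w1 w2 : Euc n → ℝ) : ℝ≥0∞ :=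
  ⨆ (c : Euc n) (h : ℝ) (_ : 0 < h), a22Ratio w1 w2 c h

/-- Weighted `L²` norm, `ℝ≥0∞`-valued. -/
def wL2 {n : ℕ} (w f : Euc n → ℝ) : ℝ≥0∞ :=
  (∫⁻ x, ENNReal.ofReal (f x ^ 2 * w x)) ^ ((1:ℝ)/2)

/-- Weighted `L¹` norm, `ℝ≥0∞`-valued. -/
def wL1 {n : ℕ} (w f : Euc n → ℝ) : ℝ≥0∞ :=
  ∫⁻ x, ENNReal.ofReal (|f x| * w x)

theorem volume_cube_ne_zero_and_ne_top {n : ℕ} (c : Euc n) {h : ℝ} (hh : 0 < h) :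
    volume (cube c h) ≠ 0 ∧ volume (cube c h) ≠ ⊤ := by
  have hcube : cube c h =
      (MeasurableEquiv.toLp 2 (Fin n → ℝ)).symm ⁻¹' Metric.closedBall (WithLp.ofLp c) h := by
    ext x
    simp [cube, closedBall_pi _ hh.le, Real.dist_eq]
  rw [hcube,
    (EuclideanSpace.volume_preserving_symm_measurableEquiv_toLp (Fin n)).measure_preimage_equiv]
  exact ⟨(Metric.measure_closedBall_pos volume _ hh).ne', measure_closedBall_lt_top.ne⟩

theorem eAvg_eq_lintegral {n : ℕ} (w : Euc n → ℝ) (c : Euc n) (h : ℝ) :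
    eAvg w c h =
      ∫⁻ x, ENNReal.ofReal (w x) ∂((volume (cube c h))⁻¹ • volume.restrict (cube c h)) := by
  rw [lintegral_smul_measure, eAvg, ENNReal.div_eq_inv_mul, smul_eq_mul]

theorem eAvg_one {n : ℕ} (c : Euc n) {h : ℝ} (hh : 0 < h) : eAvg (fun _ => 1) c h = 1 := by
  obtain ⟨h0, h1⟩ := volume_cube_ne_zero_and_ne_top c hh
  simp [eAvg, ENNReal.div_self h0 h1]

theorem eAvg_congr {n : ℕ} {u v : Euc n → ℝ} (huv : u =ᵐ[volume] v) (c : Euc n) (h : ℝ) :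
    eAvg u c h = eAvg v c h := by
  unfold eAvg
  congr 1
  refine lintegral_congr_ae (ae_restrict_of_ae ?_)
  filter_upwards [huv] with x hx
  rw [hx]

/-- Hölder's inequality for averages over cubes. -/
theorem eAvg_le_rpow_mul_rpow {n : ℕ} {u f g : Euc n → ℝ} {p q : ℝ}
    (hp : 0 ≤ p) (hq : 0 ≤ q) (hpq : p + q = 1)
    (hf : AEMeasurable f) (hg : AEMeasurable g)
    (hf0 : ∀ᵐ x, 0 < f x) (hg0 : ∀ᵐ x, 0 < g x)
    (hu : ∀ᵐ x, u x = f x ^ p * g x ^ q) (c : Euc n) (h : ℝ) :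
    eAvg u c h ≤ eAvg f c h ^ p * eAvg g c h ^ q := by
  have hac : (volume (cube c h))⁻¹ • volume.restrict (cube c h) ≪ (volume : Measure (Euc n)) :=
    Measure.smul_absolutelyContinuous.trans Measure.restrict_le_self.absolutelyContinuous
  simp only [eAvg_eq_lintegral]
  refine le_trans (lintegral_mono_ae (hac.ae_le ?_)) (ENNReal.lintegral_mul_norm_pow_le
    (hf.mono_ac hac).ennreal_ofReal (hg.mono_ac hac).ennreal_ofReal hp hq hpq)
  filter_upwards [hf0, hg0, hu] with x hfx hgx hux
  rw [hux, ENNReal.ofReal_mul (by positivity), ENNReal.ofReal_rpow_of_pos hfx,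
    ENNReal.ofReal_rpow_of_pos hgx]

theorem apRatio_two {n : ℕ} (w : Euc n → ℝ) (c : Euc n) (h : ℝ) :
    apRatio 2 w c h = eAvg w c h * eAvg (fun x => (w x)⁻¹) c h := by
  have h1 : (1 : ℝ) - conjExp 2 = -1 := by norm_num [conjExp]
  have h2 : (2 : ℝ) - 1 = 1 := by norm_num
  simp only [apRatio, h1, h2, Real.rpow_neg_one, ENNReal.rpow_one]

theorem apRatio_four_inv {n : ℕ} {w : Euc n → ℝ} (hw : ∀ᵐ x, 0 < w x) (c : Euc n) (h : ℝ) :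
    apRatio 4 (fun x => (w x)⁻¹) c h =
      eAvg (fun x => (w x)⁻¹) c h * eAvg (fun x => w x ^ ((1 : ℝ) / 3)) c h ^ (3 : ℝ) := by
  have h1 : (1 : ℝ) - conjExp 4 = -(1 / 3) := by norm_num [conjExp]
  have h2 : (4 : ℝ) - 1 = 3 := by norm_num
  rw [apRatio, h1, h2, eAvg_congr (u := fun x => (w x)⁻¹ ^ (-((1 : ℝ) / 3)))
    (v := fun x => w x ^ ((1 : ℝ) / 3))]
  filter_upwards [hw] with x hx
  rw [Real.inv_rpow hx.le, Real.rpow_neg hx.le, inv_inv]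

theorem apRatio_le_apConst {n : ℕ} (p : ℝ) (w : Euc n → ℝ) (c : Euc n) {h : ℝ} (hh : 0 < h) :
    apRatio p w c h ≤ apConst n p w :=
  le_iSup_of_le c (le_iSup_of_le h (le_iSup_of_le hh le_rfl))

theorem a22Ratio_le_a22Const {n : ℕ} (w1 w2 : Euc n → ℝ) (c : Euc n) {h : ℝ} (hh : 0 < h) :
    a22Ratio w1 w2 c h ≤ a22Const n w1 w2 :=
  le_iSup_of_le c (le_iSup_of_le h (le_iSup_of_le hh le_rfl))

theorem a22Const_comm (n : ℕ) (w1 w2 : Euc n → ℝ) : a22Const n w1 w2 = a22Const n w2 w1 := by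
  have (c : Euc n) (h : ℝ) : a22Ratio w1 w2 c h = a22Ratio w2 w1 c h := by
    simp only [a22Ratio, mul_comm]
  simp only [a22Const, this]

theorem IsWeight.aemeasurable {n : ℕ} {w : Euc n → ℝ} (hw : IsWeight w) : AEMeasurable w :=
  hw.1.aestronglyMeasurable.aemeasurable

theorem apConst_two_le_a22Const {n : ℕ} {w1 w2 : Euc n → ℝ}
    (hw1 : IsWeight w1) (hw2 : IsWeight w2) :
    apConst n 2 (fun x => w1 x ^ ((1 : ℝ) / 2) * w2 x ^ ((1 : ℝ) / 2)) ≤ a22Const n w1 w2 := by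
  refine iSup_le fun c => iSup_le fun h => iSup_le fun hh => ?_
  refine le_trans ?_ (a22Ratio_le_a22Const w1 w2 c hh)
  rw [apRatio_two, a22Ratio]
  gcongr
  refine eAvg_le_rpow_mul_rpow (by norm_num) (by norm_num) (by norm_num)
    hw1.aemeasurable.inv hw2.aemeasurable.inv
    (hw1.2.mono fun x => inv_pos.2) (hw2.2.mono fun x => inv_pos.2) ?_ c h
  filter_upwards [hw1.2, hw2.2] with x h1 h2
  rw [Pi.inv_apply, Pi.inv_apply, Real.inv_rpow h1.le, Real.inv_rpow h2.le, mul_inv]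

theorem apConst_four_inv_le_a22Const {n : ℕ} {w1 w2 : Euc n → ℝ}
    (hw1 : IsWeight w1) (hw2 : IsWeight w2) :
    apConst n 4 (fun x => (w1 x)⁻¹) ≤ a22Const n w1 w2 ^ (2 : ℝ) := by
  refine iSup_le fun c => iSup_le fun h => iSup_le fun hh => ?_
  refine le_trans ?_ (ENNReal.rpow_le_rpow (a22Ratio_le_a22Const w1 w2 c hh) zero_le_two)
  have holder : eAvg (fun x => w1 x ^ ((1 : ℝ) / 3)) c h ≤
      eAvg (fun x => w1 x ^ ((1 : ℝ) / 2) * w2 x ^ ((1 : ℝ) / 2)) c h ^ ((2 : ℝ) / 3) *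
        eAvg (fun x => (w2 x)⁻¹) c h ^ ((1 : ℝ) / 3) := by
    refine eAvg_le_rpow_mul_rpow (by norm_num) (by norm_num) (by norm_num)
      ((hw1.aemeasurable.pow_const _).mul (hw2.aemeasurable.pow_const _)) hw2.aemeasurable.inv
      ?_ (hw2.2.mono fun x => inv_pos.2) ?_ c h
    · filter_upwards [hw1.2, hw2.2] with x h1 h2
      simp only [Pi.mul_apply]
      positivity
    · filter_upwards [hw1.2, hw2.2] with x h1 h2
      rw [Pi.mul_apply, Real.mul_rpow (by positivity) (by positivity), ← Real.rpow_mul h1.le,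
        ← Real.rpow_mul h2.le, Pi.inv_apply, Real.inv_rpow h2.le, mul_assoc]
      norm_num
      rw [mul_inv_cancel₀ (by positivity), mul_one]
  rw [apRatio_four_inv hw1.2, a22Ratio]
  refine (mul_le_mul_right (ENNReal.rpow_le_rpow holder (by norm_num)) _).trans_eq ?_
  simp only [ENNReal.mul_rpow_of_nonneg _ _ zero_le_two,
    ENNReal.mul_rpow_of_nonneg _ _ (zero_le_three (α := ℝ)), ← ENNReal.rpow_mul]
  norm_num
  ring

/-- Hölder's inequality applied to `1 = ν^{-1/4} (w₁^{1/3})^{3/8} (w₂^{1/3})^{3/8}`. -/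
theorem one_le_eAvg_mul_eAvg_mul_eAvg {n : ℕ} {w1 w2 : Euc n → ℝ}
    (hw1 : IsWeight w1) (hw2 : IsWeight w2) (c : Euc n) {h : ℝ} (hh : 0 < h) :
    1 ≤ eAvg (fun x => (w1 x ^ ((1 : ℝ) / 2) * w2 x ^ ((1 : ℝ) / 2))⁻¹) c h *
      (eAvg (fun x => w1 x ^ ((1 : ℝ) / 3)) c h ^ ((3 : ℝ) / 2) *
        eAvg (fun x => w2 x ^ ((1 : ℝ) / 3)) c h ^ ((3 : ℝ) / 2)) := by
  have geom : eAvg (fun x => w1 x ^ ((1 : ℝ) / 6) * w2 x ^ ((1 : ℝ) / 6)) c h ≤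
      eAvg (fun x => w1 x ^ ((1 : ℝ) / 3)) c h ^ ((1 : ℝ) / 2) *
        eAvg (fun x => w2 x ^ ((1 : ℝ) / 3)) c h ^ ((1 : ℝ) / 2) := by
    refine eAvg_le_rpow_mul_rpow (by norm_num) (by norm_num) (by norm_num)
      (hw1.aemeasurable.pow_const _) (hw2.aemeasurable.pow_const _)
      (hw1.2.mono fun x hx => Real.rpow_pos_of_pos hx _)
      (hw2.2.mono fun x hx => Real.rpow_pos_of_pos hx _) ?_ c h
    filter_upwards [hw1.2, hw2.2] with x h1 h2
    rw [← Real.rpow_mul h1.le, ← Real.rpow_mul h2.le]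
    norm_num
  have holder : eAvg (fun _ => 1) c h ≤
      eAvg (fun x => (w1 x ^ ((1 : ℝ) / 2) * w2 x ^ ((1 : ℝ) / 2))⁻¹) c h ^ ((1 : ℝ) / 4) *
        eAvg (fun x => w1 x ^ ((1 : ℝ) / 6) * w2 x ^ ((1 : ℝ) / 6)) c h ^ ((3 : ℝ) / 4) := by
    refine eAvg_le_rpow_mul_rpow (by norm_num) (by norm_num) (by norm_num)
      ((hw1.aemeasurable.pow_const _).mul (hw2.aemeasurable.pow_const _)).inv
      ((hw1.aemeasurable.pow_const _).mul (hw2.aemeasurable.pow_const _)) ?_ ?_ ?_ c h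
    · filter_upwards [hw1.2, hw2.2] with x h1 h2
      simp only [Pi.inv_apply, Pi.mul_apply]
      positivity
    · filter_upwards [hw1.2, hw2.2] with x h1 h2
      simp only [Pi.mul_apply]
      positivity
    · filter_upwards [hw1.2, hw2.2] with x h1 h2
      simp only [Pi.inv_apply, Pi.mul_apply]
      rw [Real.inv_rpow (by positivity), Real.mul_rpow (by positivity) (by positivity),
        Real.mul_rpow (by positivity) (by positivity), ← Real.rpow_mul h1.le,
        ← Real.rpow_mul h2.le, ← Real.rpow_mul h1.le, ← Real.rpow_mul h2.le]
      norm_num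
      field_simp
  rw [eAvg_one c hh] at holder
  have key := ENNReal.rpow_le_rpow
    (holder.trans (mul_le_mul_right (ENNReal.rpow_le_rpow geom (by norm_num)) _))
    (zero_le_four (α := ℝ))
  refine (ENNReal.one_rpow (4 : ℝ)).symm.trans_le (key.trans_eq ?_)
  simp only [ENNReal.mul_rpow_of_nonneg _ _ (zero_le_four (α := ℝ)),
    ENNReal.mul_rpow_of_nonneg _ _ (show (0 : ℝ) ≤ 3 / 4 by norm_num), ← ENNReal.rpow_mul]
  norm_num

theorem a22Const_le_apConst_mul {n : ℕ} {w1 w2 : Euc n → ℝ}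
    (hw1 : IsWeight w1) (hw2 : IsWeight w2) :
    a22Const n w1 w2 ≤ apConst n 2 (fun x => w1 x ^ ((1 : ℝ) / 2) * w2 x ^ ((1 : ℝ) / 2)) *
      (apConst n 4 (fun x => (w1 x)⁻¹) ^ ((1 : ℝ) / 2) *
        apConst n 4 (fun x => (w2 x)⁻¹) ^ ((1 : ℝ) / 2)) := by
  refine iSup_le fun c => iSup_le fun h => iSup_le fun hh => ?_
  have half : (0 : ℝ) ≤ 1 / 2 := by norm_num
  refine le_trans ?_ (mul_le_mul' (apRatio_le_apConst 2 _ c hh)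
    (mul_le_mul' (ENNReal.rpow_le_rpow (apRatio_le_apConst 4 _ c hh) half)
      (ENNReal.rpow_le_rpow (apRatio_le_apConst 4 _ c hh) half)))
  rw [apRatio_two, apRatio_four_inv hw1.2, apRatio_four_inv hw2.2, a22Ratio]
  refine (le_mul_of_one_le_right' (one_le_eAvg_mul_eAvg_mul_eAvg hw1 hw2 c hh)).trans_eq ?_
  simp only [ENNReal.mul_rpow_of_nonneg _ _ half, ← ENNReal.rpow_mul]
  norm_num
  ring

/-- Characterization of bilinear `A_{(2,2)}` weights.
`(ω₁, ω₂) ∈ A_{(2,2)}` if and only if `ω₁⁻¹ ∈ A₄`, `ω₂⁻¹ ∈ A₄` and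
`ν = ω₁^{1/2} ω₂^{1/2} ∈ A₂`. -/
theorem a22_characterization (n : ℕ) (w1 w2 : Euc n → ℝ)
    (hw1 : IsWeight w1) (hw2 : IsWeight w2) :
    a22Const n w1 w2 < ⊤ ↔
      (apConst n 4 (fun x => (w1 x)⁻¹) < ⊤ ∧ apConst n 4 (fun x => (w2 x)⁻¹) < ⊤ ∧
        apConst n 2 (fun x => w1 x ^ ((1:ℝ)/2) * w2 x ^ ((1:ℝ)/2)) < ⊤) := by
  constructor
  · intro h
    refine ⟨?_, ?_, (apConst_two_le_a22Const hw1 hw2).trans_lt h⟩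
    · exact (apConst_four_inv_le_a22Const hw1 hw2).trans_lt
        (ENNReal.rpow_lt_top_of_nonneg zero_le_two h.ne)
    · rw [a22Const_comm] at h
      exact (apConst_four_inv_le_a22Const hw2 hw1).trans_lt
        (ENNReal.rpow_lt_top_of_nonneg zero_le_two h.ne)
  · rintro ⟨h1, h2, h3⟩
    exact (a22Const_le_apConst_mul hw1 hw2).trans_lt (ENNReal.mul_lt_top h3 (ENNReal.mul_lt_top
      (ENNReal.rpow_lt_top_of_nonneg (by norm_num) h1.ne)
      (ENNReal.rpow_lt_top_of_nonneg (by norm_num) h2.ne)))
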